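/- Let A(n,m) denote the number of full binary trees T with V(T) = n and JD(T) = m, and let b_j denote the number of full binary trees with j internal vertices. Then A(0,0) = 1, A(0,m) = 0 for m ≥ 1, and for all n ≥ 1 and m ≥ 0: A(n,m) = Σ_{j=0}^{min(n−1, m)} b_j · A(n−1−j, m−j). (This is the coefficient form of the identity K(x,q) = 1 + x·f(qx)·K(x,q), equivalent to the explicit expression K(x,q) = 2q/(√(1−4qx) − 1 + 2q) for the weight-enumerator of all full binary trees by x^{V(T)} q^{JD(T)}.) -/

import Mathlib

inductive BTree : Type
  | leaf : BTree
  | node : BTree → BTree → BTree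

namespace BTree

/-- number of internal vertices -/
def V : BTree → ℕ
  | leaf => 0
  | node l r => V l + V r + 1

/-- depth of the rightmost leaf -/
def D : BTree → ℕ
  | leaf => 0
  | node _ r => 1 + D r

/-- number of jumps -/
def J : BTree → ℕ
  | leaf => 0
  | node leaf r => J r
  | node (node l₁ r₁) r => J (node l₁ r₁) + J r + 1

/-- sum of jump distances -/
def JD : BTree → ℕ
  | leaf => 0
  | node l r => JD l + JD r + D l

end BTree

namespace BTree

theorem JD_add_D (T : BTree) : T.JD + T.D = T.V := by
  induction T with
  | leaf => rfl
  | node l r ihl ihr => simp only [JD, D, V]; omega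

theorem finite_V_le (n : ℕ) : {T : BTree | T.V ≤ n}.Finite := by
  induction n with
  | zero =>
    refine (Set.finite_singleton leaf).subset ?_
    rintro (_ | ⟨l, r⟩) h
    · rfl
    · simp [V] at h
  | succ n ih =>
    refine ((Set.finite_singleton leaf).union (Set.Finite.image2 node ih ih)).subset ?_
    rintro (_ | ⟨l, r⟩) h
    · left; rfl
    · right
      simp only [V, Set.mem_setOf_eq] at h
      exact ⟨l, by simp only [Set.mem_setOf_eq]; omega, r,
        by simp only [Set.mem_setOf_eq]; omega, rfl⟩

theorem finite_V (n : ℕ) : Finite {T : BTree // T.V = n} :=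
  ((finite_V_le n).subset (fun _ h => le_of_eq h) : {T : BTree | T.V = n}.Finite)

theorem finite_VJD (n m : ℕ) : Finite {T : BTree // T.V = n ∧ T.JD = m} :=
  ((finite_V_le n).subset (fun _ h => le_of_eq h.1) : {T : BTree | T.V = n ∧ T.JD = m}.Finite)

/-- gluing a left and a right subtree -/
def glue (n m : ℕ) : (Σ j : Fin (min n m + 1),
    {T : BTree // T.V = j} × {T : BTree // T.V = n - j ∧ T.JD = m - j}) →
    {T : BTree // T.V = n + 1 ∧ T.JD = m} :=
  fun x => ⟨node x.2.1.1 x.2.2.1, by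
    obtain ⟨⟨j, hj⟩, ⟨l, hl⟩, ⟨r, hr, hr'⟩⟩ := x
    have := JD_add_D l
    simp only [V, JD] at *
    omega⟩

theorem glue_bijective (n m : ℕ) : Function.Bijective (glue n m) := by
  constructor
  · rintro ⟨⟨j, hj⟩, ⟨l, hl⟩, ⟨r, hr⟩⟩ ⟨⟨j', hj'⟩, ⟨l', hl'⟩, ⟨r', hr'⟩⟩ h
    simp only [glue, Subtype.mk.injEq, node.injEq] at h
    obtain ⟨rfl, rfl⟩ := h
    simp only at hl hl'
    subst hl
    subst hl'
    rfl
  · rintro ⟨_ | ⟨l, r⟩, h, h'⟩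
    · simp [V] at h
    · have := JD_add_D l
      simp only [V, JD] at h h'
      exact ⟨⟨⟨l.V, by omega⟩, ⟨l, rfl⟩, ⟨r, by simp only; omega, by simp only; omega⟩⟩, rfl⟩

end BTree

/-- Coefficient form of the identity K(x,q) = 1 + x·f(qx)·K(x,q), where
A(n,m) counts full binary trees with V = n, JD = m and b_j counts full binary
trees with j internal vertices. -/
theorem stmt_8
    (A : ℕ → ℕ → ℕ) (hA : ∀ n m, A n m = Nat.card {T : BTree // T.V = n ∧ T.JD = m})
    (b : ℕ → ℕ) (hb : ∀ j, b j = Nat.card {T : BTree // T.V = j}) :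
    A 0 0 = 1 ∧
    (∀ m, 1 ≤ m → A 0 m = 0) ∧
    (∀ n, 1 ≤ n → ∀ m,
      A n m = ∑ j ∈ Finset.range (min (n - 1) m + 1), b j * A (n - 1 - j) (m - j)) := by
  refine ⟨?_, ?_, ?_⟩
  · rw [hA, Nat.card_eq_one_iff_unique]
    refine ⟨⟨?_⟩, ⟨⟨BTree.leaf, rfl, rfl⟩⟩⟩
    rintro ⟨_ | ⟨l, r⟩, h, h'⟩ ⟨_ | ⟨l', r'⟩, k, k'⟩
    · rfl
    all_goals simp [BTree.V] at h k
  · intro m hm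
    rw [hA, Nat.card_eq_zero]
    left
    refine ⟨?_⟩
    rintro ⟨T, h, h'⟩
    have := BTree.JD_add_D T
    omega
  · intro n hn m
    obtain ⟨n, rfl⟩ : ∃ k, n = k + 1 := ⟨n - 1, by omega⟩
    have := BTree.finite_V
    have := BTree.finite_VJD
    rw [hA, ← Nat.card_congr (Equiv.ofBijective _ (BTree.glue_bijective n m)),
      Nat.card_sigma, Nat.add_sub_cancel, Finset.sum_range]
    refine Finset.sum_congr rfl fun j _ => ?_
    rw [Nat.card_prod, hb, hA]
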